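/- Let G be a finite group and H a subgroup of G. Then (G,H) is an admissible pair if and only if for all irreducible complex representations τ_i, τ_j, τ_k of H and every g ∈ H one has (Ind_H^G(χ_{τ_i}·χ_{τ_j}))(g) · χ_{τ_k}(g) = χ_{τ_i}(g) · (Ind_H^G(χ_{τ_j}·χ_{τ_k}))(g). -/

import Mathlib

open CategoryTheory
open scoped Classical

/-- The pair `(G, H)` is *admissible* if for every irreducible complex representation `τ`
of `H` with character `χ_τ`, every `g ∈ H` and every `s ∈ G` with `s g s⁻¹ ∈ H`, one has
`χ_τ(s g s⁻¹) = χ_τ(g)`. -/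
def IsAdmissiblePair (G : Type) [Group G] (H : Subgroup G) : Prop :=
  ∀ (τ : FDRep ℂ H), Simple τ →
    ∀ (g : H) (s : G) (hs : s * (g : G) * s⁻¹ ∈ H),
      τ.character ⟨s * (g : G) * s⁻¹, hs⟩ = τ.character g

/-- The class function on `G` induced from a class function `χ` on the subgroup `H`:
`(Ind_H^G χ)(g) = (1/|H|) · Σ_{s ∈ G, s g s⁻¹ ∈ H} χ(s g s⁻¹)`. -/
noncomputable def indClass {G : Type} [Group G] [Fintype G] (H : Subgroup G)
    (χ : H → ℂ) (g : G) : ℂ :=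
  (Nat.card H : ℂ)⁻¹ *
    ∑ s : G, if hs : s * g * s⁻¹ ∈ H then χ ⟨s * g * s⁻¹, hs⟩ else 0

open scoped ComplexOrder in
theorem matrix_trace_inv_eq_star {K : Type} [Group K] [Fintype K] {n : Type} [Fintype n]
    [DecidableEq n] (M : K →* Matrix n n ℂ) (g : K) :
    (M g⁻¹).trace = star (M g).trace := by
  set P : Matrix n n ℂ := ∑ h : K, (M h).conjTranspose * M h with hP
  have hinv : (M g).conjTranspose * P * M g = P := by
    rw [hP, Finset.mul_sum, Finset.sum_mul]
    rw [← Equiv.sum_comp (Equiv.mulRight g) (fun h => (M h).conjTranspose * M h)]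
    refine Finset.sum_congr rfl fun h _ => ?_
    simp [Matrix.conjTranspose_mul, Matrix.mul_assoc]
  have hpos : P.PosDef := by
    rw [hP, ← Finset.add_sum_erase _ _ (Finset.mem_univ (1 : K))]
    refine Matrix.PosDef.add_posSemidef ?_ ?_
    · simpa using Matrix.PosDef.one
    · exact Matrix.posSemidef_sum _ fun h _ => Matrix.posSemidef_conjTranspose_mul_self _
  have hu : IsUnit P.det := (Matrix.isUnit_iff_isUnit_det P).mp hpos.isUnit
  have hg : M g * M g⁻¹ = 1 := by rw [← map_mul]; simp
  have h1 : (M g).conjTranspose * P = P * M g⁻¹ := by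
    calc (M g).conjTranspose * P = (M g).conjTranspose * P * (M g * M g⁻¹) := by
          rw [hg, Matrix.mul_one]
      _ = ((M g).conjTranspose * P * M g) * M g⁻¹ := by simp only [Matrix.mul_assoc]
      _ = _ := by rw [hinv]
  have h2 : M g⁻¹ = P⁻¹ * ((M g).conjTranspose * P) := by
    rw [h1, Matrix.nonsing_inv_mul_cancel_left _ _ hu]
  rw [h2, Matrix.trace_mul_comm, Matrix.mul_assoc, Matrix.mul_nonsing_inv _ hu, Matrix.mul_one,
    Matrix.trace_conjTranspose]

theorem character_inv_eq_star {K : Type} [Group K] [Fintype K] (V : FDRep ℂ K) (g : K) :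
    V.character g⁻¹ = star (V.character g) := by
  let b := Module.finBasis ℂ V
  let M : K →* Matrix (Fin (Module.finrank ℂ V)) (Fin (Module.finrank ℂ V)) ℂ :=
    ((LinearMap.toMatrixAlgEquiv b : _ ≃ₐ[ℂ] _) : _ →* _).comp V.ρ
  have key : ∀ x, V.character x = (M x).trace := fun x =>
    LinearMap.trace_eq_matrix_trace ℂ b (V.ρ x)
  rw [key, key, matrix_trace_inv_eq_star]

theorem simple_dual {K : Type} [Group K] [Fintype K] (V : FDRep ℂ K) (hV : Simple V) :
    Simple (FDRep.of (Representation.dual V.ρ)) := by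
  rw [FDRep.simple_iff_char_is_norm_one] at hV ⊢
  rw [← hV]
  refine Finset.sum_congr rfl fun g _ => ?_
  rw [FDRep.char_dual, FDRep.char_dual, inv_inv, mul_comm]

theorem character_triv {K : Type} [Group K] (g : K) :
    (FDRep.of (Representation.trivial ℂ K ℂ)).character g = 1 := by
  have : (FDRep.of (Representation.trivial ℂ K ℂ)).character g
      = LinearMap.trace ℂ ℂ LinearMap.id := rfl
  rw [this]; simp

theorem simple_triv {K : Type} [Group K] [Fintype K] :
    Simple (FDRep.of (Representation.trivial ℂ K ℂ)) := by
  rw [FDRep.simple_iff_char_is_norm_one]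
  simp [character_triv]

theorem indClass_of_const {G : Type} [Group G] [Fintype G] (H : Subgroup G) (χ : H → ℂ) (g : H)
    (h : ∀ (s : G) (hs : s * (g : G) * s⁻¹ ∈ H), χ ⟨s * (g : G) * s⁻¹, hs⟩ = χ g) :
    indClass H χ g = χ g * indClass H (fun _ => 1) g := by
  unfold indClass
  rw [mul_left_comm, Finset.mul_sum _ _ (χ g)]
  congr 1
  refine Finset.sum_congr rfl fun s _ => ?_
  split_ifs with hs
  · rw [h, mul_one]
  · simp

/-- `(G,H)` is an admissible pair if and only if the associativity identity (A4) holds: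
for all irreducible `τ_i, τ_j, τ_k` of `H` and all `g ∈ H`,
`Ind_H^G(χ_{τ_i}·χ_{τ_j})(g) · χ_{τ_k}(g) = χ_{τ_i}(g) · Ind_H^G(χ_{τ_j}·χ_{τ_k})(g)`. -/
theorem isAdmissiblePair_iff_assoc (G : Type) [Group G] [Fintype G] (H : Subgroup G) :
    IsAdmissiblePair G H ↔
      ∀ (τi τj τk : FDRep ℂ H), Simple τi → Simple τj → Simple τk →
        ∀ g : H,
          indClass H (fun x => τi.character x * τj.character x) (g : G) * τk.character g
            = τi.character g *
                indClass H (fun x => τj.character x * τk.character x) (g : G) := by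
  constructor
  · intro h τi τj τk hi hj hk g
    rw [indClass_of_const H _ g, indClass_of_const H (fun x => τj.character x * τk.character x) g]
    · ring
    · intro s hs
      simp only [h τj hj g s hs, h τk hk g s hs]
    · intro s hs
      simp only [h τi hi g s hs, h τj hj g s hs]
  · intro h τ hτ g s hs
    have hd := simple_dual τ hτ
    have ht := simple_triv (K := H)
    have hdc : ∀ x, (FDRep.of (Representation.dual τ.ρ)).character x = star (τ.character x) :=
      fun x => by rw [FDRep.char_dual, character_inv_eq_star]
    have h1 := h _ _ _ hτ ht ht g
    have h2 := h _ _ _ hd ht ht g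
    have h3 := h _ _ _ hτ hd ht g
    simp only [hdc, character_triv, mul_one] at h1 h2 h3
    have hc : (Nat.card H : ℂ)⁻¹ ≠ 0 := by simp
    set a : ℂ := τ.character g with ha
    have hlin : indClass H (fun x => (τ.character x - a) * star (τ.character x - a)) g
        = indClass H (fun x => τ.character x * star (τ.character x)) g
          - a * indClass H (fun x => star (τ.character x)) g
          - star a * indClass H (fun x => τ.character x) g
          + a * star a * indClass H (fun _ => 1) g := by
      unfold indClass
      simp only [mul_left_comm _ (Nat.card H : ℂ)⁻¹, ← mul_sub, ← mul_add]
      congr 1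
      simp only [Finset.mul_sum, ← Finset.sum_sub_distrib, ← Finset.sum_add_distrib]
      refine Finset.sum_congr rfl fun s _ => ?_
      split_ifs
      · rw [star_sub]; ring
      · simp
    have hzero : indClass H (fun x => (τ.character x - a) * star (τ.character x - a)) g = 0 := by
      rw [hlin, h3, h2]
      rw [show indClass H (fun x => τ.character x) g = a * indClass H (fun _ => 1) g from h1]
      ring
    unfold indClass at hzero
    have hsum := (mul_eq_zero.mp hzero).resolve_left hc
    let f : G → ℝ := fun s => if hs : s * (g : G) * s⁻¹ ∈ H then
      Complex.normSq (τ.character ⟨s * (g : G) * s⁻¹, hs⟩ - a) else 0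
    have hf : ∑ s, f s = 0 := by
      have : ((∑ s, f s : ℝ) : ℂ) = 0 := by
        rw [← hsum, Complex.ofReal_sum]
        refine Finset.sum_congr rfl fun s _ => ?_
        simp only [f]
        split_ifs
        · exact (Complex.mul_conj _).symm
        · simp
      exact_mod_cast this
    have hf0 : ∀ s ∈ Finset.univ, 0 ≤ f s := by
      intro s _
      simp only [f]
      split_ifs
      · exact Complex.normSq_nonneg _
      · exact le_rfl
    have := (Finset.sum_eq_zero_iff_of_nonneg hf0).mp hf s (Finset.mem_univ s)
    simp only [f, dif_pos hs] at this
    exact sub_eq_zero.mp (Complex.normSq_eq_zero.mp this)
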